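/- For all k ∈ ℤ and m,n ∈ ℕ, in C one has: r^{k,m,n}·t_33* = q^{m+n} r^{k,m,n}·t_11 − θ(−k) q^{m+n−1}(1 − q^{−2k}) r^{k+1,m,n}·(t_12 t_21); r^{k,m,n}·t_34* = q^{1−k} r^{k,m,n}·t_12; r^{k,m,n}·t_43* = q^{−(1+k)} r^{k,m,n}·t_21; and r^{k,m,n}·t_44* = q^{−(m+n)} r^{k,m,n}·t_22 − θ(k) q (1 − q^{−2k}) r^{k−1,m,n}·(t_12 t_21), where θ(k) = 1 for k ≥ 0 and θ(k) = 0 for k < 0. -/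

import Mathlib

open scoped TensorProduct

noncomputable section

namespace QIB

/-- Generators of `A(U_q(4))`: the matrix entries `t i j` and the extra generator `D_q⁻¹`. -/
abbrev genU : Type := (Fin 4 × Fin 4) ⊕ Unit

abbrev FU : Type := FreeAlgebra ℂ genU

def T (i j : Fin 4) : FU := FreeAlgebra.ι ℂ (Sum.inl (i, j))

def Dinv0 : FU := FreeAlgebra.ι ℂ (Sum.inr ())

/-- The length (number of inversions) of a permutation of `Fin 4`. -/
def plen (σ : Equiv.Perm (Fin 4)) : ℕ :=
  ((Finset.univ : Finset (Fin 4 × Fin 4)).filter fun p => p.1 < p.2 ∧ σ p.2 < σ p.1).card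

/-- The quantum determinant, as an element of the free algebra. -/
def Dq0 (q : ℝ) : FU :=
  ∑ σ : Equiv.Perm (Fin 4),
    ((-(q : ℂ)) ^ plen σ) • (T (σ 0) 0 * T (σ 1) 1 * T (σ 2) 2 * T (σ 3) 3)

/-- The defining relations of `A(U_q(4))`. -/
inductive relU (q : ℝ) : FU → FU → Prop
  | col {i j k : Fin 4} : i < j → relU q (T i k * T j k) ((q : ℂ) • (T j k * T i k))
  | row {i j k : Fin 4} : i < j → relU q (T k i * T k j) ((q : ℂ) • (T k j * T k i))
  | comm {i j k l : Fin 4} : i < j → k < l → relU q (T i l * T j k) (T j k * T i l)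
  | qcom {i j k l : Fin 4} : i < j → k < l →
      relU q (T i k * T j l - T j l * T i k) (((q : ℂ) - (q : ℂ)⁻¹) • (T j k * T i l))
  | dr : relU q (Dq0 q * Dinv0) 1
  | dl : relU q (Dinv0 * Dq0 q) 1

variable (q : ℝ)

/-- The algebra `A(U_q(4))`. -/
abbrev AU : Type := RingQuot (relU q)

/-- The generators `t i j` of `A(U_q(4))` (indices are 0-based). -/
def tt (i j : Fin 4) : AU q := RingQuot.mkAlgHom ℂ (relU q) (T i j)

/-- The generator `D_q⁻¹`. -/
def dI : AU q := RingQuot.mkAlgHom ℂ (relU q) Dinv0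

/-- The quantum determinant `D_q` in `A(U_q(4))`. -/
def Dq : AU q := RingQuot.mkAlgHom ℂ (relU q) (Dq0 q)

/-- The spanning set `R` of relation elements (0-based indices). -/
def Rset : Set (AU q) :=
  {tt q 0 2, tt q 2 0, tt q 0 3, tt q 3 0, tt q 1 3, tt q 3 1, tt q 1 2, tt q 2 1,
   tt q 0 0 - tt q 3 3, tt q 0 1 + tt q 3 2, tt q 1 0 + tt q 2 3, tt q 1 1 - tt q 2 2,
   tt q 0 0 * tt q 1 1 - (q : ℂ) • (tt q 0 1 * tt q 1 0) - 1}

/-- The right ideal `ℛ = R · A(U_q(4))`, as a `ℂ`-submodule. -/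
def RIdeal : Submodule ℂ (AU q) :=
  Submodule.span ℂ {y | ∃ x ∈ Rset q, ∃ a : AU q, y = x * a}

/-- The coalgebra `C = A(U_q(4)) / ℛ`. -/
abbrev Cq : Type := AU q ⧸ RIdeal q

/-- The canonical projection `r : A(U_q(4)) → C`. -/
def rr : AU q →ₗ[ℂ] Cq q := (RIdeal q).mkQ

lemma RIdeal_mul_right {y : AU q} (hy : y ∈ RIdeal q) (c : AU q) : y * c ∈ RIdeal q := by
  induction hy using Submodule.span_induction with
  | mem x hx =>
      obtain ⟨x0, hx0, a, rfl⟩ := hx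
      exact Submodule.subset_span ⟨x0, hx0, a * c, by rw [mul_assoc]⟩
  | zero => simp
  | add u v _ _ hu hv => simpa [add_mul] using (RIdeal q).add_mem hu hv
  | smul a u _ hu => simpa [smul_mul_assoc] using (RIdeal q).smul_mem a hu

/-- Auxiliary map for the right `A(U_q(4))`-module structure of `C`:
right multiplication by `c` descends to the quotient. -/
def cactAux (c : AU q) : Cq q →ₗ[ℂ] Cq q :=
  Submodule.liftQ (RIdeal q) ((RIdeal q).mkQ ∘ₗ LinearMap.mulRight ℂ c)
    (by
      intro y hy
      simp only [LinearMap.mem_ker, LinearMap.comp_apply, LinearMap.mulRight_apply,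
        Submodule.mkQ_apply, Submodule.Quotient.mk_eq_zero]
      exact RIdeal_mul_right q hy c)

@[simp] lemma cactAux_mk (c a : AU q) :
    cactAux q c (Submodule.Quotient.mk a) = (Submodule.Quotient.mk (a * c) : Cq q) := by
  simp [cactAux]

/-- The right `A(U_q(4))`-module structure `r(t) · t' := r(t t')` of `C`,
as a bilinear map `A(U_q(4)) →ₗ C →ₗ C`, `(c, x) ↦ x · c`. -/
def cact : AU q →ₗ[ℂ] Cq q →ₗ[ℂ] Cq q where
  toFun c := cactAux q c
  map_add' c c' := by
    refine LinearMap.ext fun x => ?_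
    obtain ⟨a, rfl⟩ := Submodule.Quotient.mk_surjective _ x
    simp only [cactAux_mk, mul_add, Submodule.Quotient.mk_add, LinearMap.add_apply]
  map_smul' s c := by
    refine LinearMap.ext fun x => ?_
    obtain ⟨a, rfl⟩ := Submodule.Quotient.mk_surjective _ x
    simp only [cactAux_mk, mul_smul_comm, Submodule.Quotient.mk_smul, RingHom.id_apply, LinearMap.smul_apply]

@[simp] lemma cact_mk (c a : AU q) : cact q c (rr q a) = rr q (a * c) := by
  simp [cact, rr]

/-- θ(k) = 1 for k ≥ 0 and 0 for k < 0. -/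
def thetaZ (k : ℤ) : ℂ := if 0 ≤ k then 1 else 0

/-- The linear basis elements `r^{k,m,n}` of `C`, given as representatives in `A(U_q(4))`. -/
def bas (k : ℤ) (m n : ℕ) : AU q :=
  if 0 ≤ k then tt q 0 0 ^ k.toNat * tt q 0 1 ^ m * tt q 1 0 ^ n
  else tt q 0 1 ^ m * tt q 1 0 ^ n * tt q 1 1 ^ (-k).toNat

/-! ### The quantum seven-sphere -/

/-- Generators of `A(S⁷_q)`: `(i, false)` is `z_i`, `(i, true)` is `z_i^*`. -/
abbrev genS : Type := Fin 4 × Bool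

abbrev FS : Type := FreeAlgebra ℂ genS

def Z0 (i : Fin 4) : FS := FreeAlgebra.ι ℂ (i, false)

def Zs0 (i : Fin 4) : FS := FreeAlgebra.ι ℂ (i, true)

/-- The defining relations of the ∗-algebra `A(S⁷_q)` (including the ∗-conjugate of the
first family of relations, so that the relation set is closed under the involution). -/
inductive relS (q : ℝ) : FS → FS → Prop
  | zz {i j : Fin 4} : i < j → relS q (Z0 i * Z0 j) ((q : ℂ) • (Z0 j * Z0 i))
  | ss {i j : Fin 4} : i < j → relS q (Zs0 j * Zs0 i) ((q : ℂ) • (Zs0 i * Zs0 j))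
  | sz {i j : Fin 4} : i ≠ j → relS q (Zs0 j * Z0 i) ((q : ℂ) • (Z0 i * Zs0 j))
  | szz {k : Fin 4} : relS q (Zs0 k * Z0 k)
      (Z0 k * Zs0 k + (1 - (q : ℂ) ^ 2) •
        ∑ j ∈ Finset.univ.filter (· < k), Z0 j * Zs0 j)
  | sum1 : relS q (∑ k : Fin 4, Z0 k * Zs0 k) 1

/-- The algebra `P = A(S⁷_q)`. -/
abbrev PA : Type := RingQuot (relS q)

/-- The generators `z_i` of `A(S⁷_q)` (0-based index). -/
def z (i : Fin 4) : PA q := RingQuot.mkAlgHom ℂ (relS q) (Z0 i)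

/-- The generators `z_i^*` of `A(S⁷_q)` (0-based index). -/
def zs (i : Fin 4) : PA q := RingQuot.mkAlgHom ℂ (relS q) (Zs0 i)

/-- The element `R = z₁ z₁^* + z₂ z₂^*` of `A(S⁷_q)`. -/
def RRe [StarRing (PA q)] : PA q := z q 0 * star (z q 0) + z q 1 * star (z q 1)

/-- The element `a = z₁ z₄^* − z₂ z₃^*` of `A(S⁷_q)`. -/
def aa [StarRing (PA q)] : PA q := z q 0 * star (z q 3) - z q 1 * star (z q 2)

/-- The element `b = z₁ z₃ + q⁻¹ z₂ z₄` of `A(S⁷_q)`. -/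
def bb : PA q := z q 0 * z q 2 + (q : ℂ)⁻¹ • (z q 1 * z q 3)

/-- The elements `a_n = z₁ z₄^* − qⁿ z₂ z₃^*` of `A(S⁷_q)`. -/
def aN [StarRing (PA q)] (n : ℤ) : PA q :=
  z q 0 * star (z q 3) - ((q : ℂ) ^ n) • (z q 1 * star (z q 2))

/-- The elements `b_n = z₁ z₃ + q^{n−1} z₂ z₄` of `A(S⁷_q)`. -/
def bN (n : ℤ) : PA q := z q 0 * z q 2 + ((q : ℂ) ^ (n - 1)) • (z q 1 * z q 3)

/-! ### The coaction, the coinvariants and the canonical map -/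

variable (δ : PA q →ₐ[ℂ] PA q ⊗[ℂ] AU q)

/-- `Δ_r := (id ⊗ r) ∘ Δ : A(S⁷_q) → A(S⁷_q) ⊗ C`, built from the
`A(U_q(4))`-coaction `δ`. -/
def Dr : PA q →ₗ[ℂ] PA q ⊗[ℂ] Cq q :=
  (LinearMap.lTensor (PA q) (rr q)) ∘ₗ δ.toLinearMap

/-- The set of coinvariants `B = A(Σ⁴_q) = {a | Δ_r(a) = a ⊗ r(1)}`. -/
def Bset : Set (PA q) := {a : PA q | Dr q δ a = a ⊗ₜ[ℂ] rr q 1}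

/-- The subspace of `P ⊗ P` spanned by the elements `(u b) ⊗ v − u ⊗ (b v)` with `b`
a coinvariant; quotienting by it produces the balanced tensor product `P ⊗_B P`. -/
def relT : Submodule ℂ (PA q ⊗[ℂ] PA q) :=
  Submodule.span ℂ
    {x : PA q ⊗[ℂ] PA q | ∃ u v b : PA q, b ∈ Bset q δ ∧
      x = (u * b) ⊗ₜ[ℂ] v - u ⊗ₜ[ℂ] (b * v)}

set_option maxSynthPendingDepth 3 in
/-- The balanced tensor product `P ⊗_B P` over the coinvariant subalgebra `B = A(Σ⁴_q)`. -/
abbrev PBP : Type := (PA q ⊗[ℂ] PA q) ⧸ relT q δ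

set_option maxSynthPendingDepth 3 in
/-- The canonical projection `P ⊗ P → P ⊗_B P`. -/
def mkT : PA q ⊗[ℂ] PA q →ₗ[ℂ] PBP q δ := (relT q δ).mkQ

lemma relT_map_lmul (p : PA q) {x : PA q ⊗[ℂ] PA q} (hx : x ∈ relT q δ) :
    TensorProduct.map (LinearMap.mulLeft ℂ p) LinearMap.id x ∈ relT q δ := by
  induction hx using Submodule.span_induction with
  | mem y hy =>
      obtain ⟨u, v, b, hb, rfl⟩ := hy
      refine Submodule.subset_span ⟨p * u, v, b, hb, ?_⟩
      simp [TensorProduct.map_tmul, mul_assoc]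
  | zero => simp
  | add u v _ _ hu hv => simpa [map_add] using Submodule.add_mem _ hu hv
  | smul a u _ hu => simpa [map_smul] using Submodule.smul_mem _ a hu

lemma relT_map_rmul (p : PA q) {x : PA q ⊗[ℂ] PA q} (hx : x ∈ relT q δ) :
    TensorProduct.map LinearMap.id (LinearMap.mulRight ℂ p) x ∈ relT q δ := by
  induction hx using Submodule.span_induction with
  | mem y hy =>
      obtain ⟨u, v, b, hb, rfl⟩ := hy
      refine Submodule.subset_span ⟨u, v * p, b, hb, ?_⟩
      simp [TensorProduct.map_tmul, mul_assoc]
  | zero => simp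
  | add u v _ _ hu hv => simpa [map_add] using Submodule.add_mem _ hu hv
  | smul a u _ hu => simpa [map_smul] using Submodule.smul_mem _ a hu

set_option maxSynthPendingDepth 3 in
/-- Left multiplication by `p ∈ P` on the bimodule `P ⊗_B P`. -/
def lact (p : PA q) : PBP q δ →ₗ[ℂ] PBP q δ :=
  Submodule.liftQ (relT q δ)
    ((relT q δ).mkQ ∘ₗ TensorProduct.map (LinearMap.mulLeft ℂ p) LinearMap.id)
    (by
      intro x hx
      simp only [LinearMap.mem_ker, LinearMap.comp_apply, Submodule.mkQ_apply,
        Submodule.Quotient.mk_eq_zero]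
      exact relT_map_lmul q δ p hx)

set_option maxSynthPendingDepth 3 in
/-- Right multiplication by `p ∈ P` on the bimodule `P ⊗_B P`. -/
def ract (p : PA q) : PBP q δ →ₗ[ℂ] PBP q δ :=
  Submodule.liftQ (relT q δ)
    ((relT q δ).mkQ ∘ₗ TensorProduct.map LinearMap.id (LinearMap.mulRight ℂ p))
    (by
      intro x hx
      simp only [LinearMap.mem_ker, LinearMap.comp_apply, Submodule.mkQ_apply,
        Submodule.Quotient.mk_eq_zero]
      exact relT_map_rmul q δ p hx)

/-- The structure map of the right action `◁` of `A(S⁷_q)` on `A(S⁷_q) ⊗ C`: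
on simple tensors, `(u ⊗ x) ⊗ (w ⊗ y) ↦ (u w) ⊗ (x · y)`.  The action is
`(u ⊗ x) ◁ v = triMap ((u ⊗ x) ⊗ δ v) = Σ u v₍₀₎ ⊗ x · v₍₁₎`. -/
def triMap : (PA q ⊗[ℂ] Cq q) ⊗[ℂ] (PA q ⊗[ℂ] AU q) →ₗ[ℂ] PA q ⊗[ℂ] Cq q :=
  (TensorProduct.map (LinearMap.mul' ℂ (PA q)) (TensorProduct.lift (LinearMap.flip (cact q)))) ∘ₗ
    (TensorProduct.tensorTensorTensorComm ℂ (PA q) (Cq q) (PA q) (AU q)).toLinearMap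

lemma rr_mul {u w : AU q} (h : rr q u = rr q w) (y : AU q) : rr q (u * y) = rr q (w * y) := by
  rw [← cact_mk, ← cact_mk, h]

lemma rr_neg_mul {u w : AU q} (h : rr q u = - rr q w) (y : AU q) :
    rr q (u * y) = - rr q (w * y) := by
  rw [← cact_mk, ← cact_mk, h, map_neg]

lemma rr_zero_mul {u : AU q} (h : rr q u = 0) (y : AU q) : rr q (u * y) = 0 := by
  rw [← cact_mk, h, map_zero]

lemma rr_Rset {x : AU q} (hx : x ∈ Rset q) (y : AU q) : rr q (x * y) = 0 := by
  rw [rr, Submodule.mkQ_apply, Submodule.Quotient.mk_eq_zero]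
  exact Submodule.subset_span ⟨x, hx, y, rfl⟩

lemma tt_col {i j : Fin 4} (k : Fin 4) (h : i < j) :
    tt q i k * tt q j k = (q : ℂ) • (tt q j k * tt q i k) := by
  have := RingQuot.mkAlgHom_rel ℂ (relU.col (q := q) (k := k) h)
  simp only [map_mul, map_smul] at this
  exact this

lemma tt_row {i j : Fin 4} (k : Fin 4) (h : i < j) :
    tt q k i * tt q k j = (q : ℂ) • (tt q k j * tt q k i) := by
  have := RingQuot.mkAlgHom_rel ℂ (relU.row (q := q) (k := k) h)
  simp only [map_mul, map_smul] at this
  exact this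

lemma tt_comm {i j k l : Fin 4} (h : i < j) (h' : k < l) :
    tt q i l * tt q j k = tt q j k * tt q i l := by
  simpa [tt] using RingQuot.mkAlgHom_rel ℂ (relU.comm (q := q) h h')

lemma tt_qcom {i j k l : Fin 4} (h : i < j) (h' : k < l) :
    tt q i k * tt q j l = tt q j l * tt q i k
      + ((q : ℂ) - (q : ℂ)⁻¹) • (tt q j k * tt q i l) := by
  have := RingQuot.mkAlgHom_rel ℂ (relU.qcom (q := q) h h')
  simp only [map_sub, map_mul, map_smul] at this
  rw [add_comm]
  exact sub_eq_iff_eq_add.mp this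

/-- Elements behaving like those of the subalgebra generated by the upper left block. -/
structure Good (x : AU q) : Prop where
  up : ∀ i l : Fin 4, i < 2 → 2 ≤ l → rr q (x * tt q i l) = 0
  lo : ∀ i l : Fin 4, i < 2 → 2 ≤ l → rr q (x * tt q l i) = 0
  h33 : rr q (x * tt q 3 3) = rr q (tt q 0 0 * x)
  h32 : rr q (x * tt q 3 2) = - rr q (tt q 0 1 * x)
  h23 : rr q (x * tt q 2 3) = - rr q (tt q 1 0 * x)
  h22 : rr q (x * tt q 2 2) = rr q (tt q 1 1 * x)

lemma good_one : Good q 1 where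
  up := by
    intro i l hi hl
    have := rr_Rset q (x := tt q i l) (by
      fin_cases i <;> fin_cases l <;> simp_all [Rset]) 1
    simpa using this
  lo := by
    intro i l hi hl
    have := rr_Rset q (x := tt q l i) (by
      fin_cases i <;> fin_cases l <;> simp_all [Rset]) 1
    simpa using this
  h33 := by
    have := rr_Rset q (x := tt q 0 0 - tt q 3 3) (by simp [Rset]) 1
    rw [mul_one, map_sub, sub_eq_zero] at this
    rw [one_mul, mul_one, this]
  h32 := by
    have := rr_Rset q (x := tt q 0 1 + tt q 3 2) (by simp [Rset]) 1
    rw [mul_one, map_add, add_eq_zero_iff_neg_eq] at this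
    rw [one_mul, mul_one, this]
  h23 := by
    have := rr_Rset q (x := tt q 1 0 + tt q 2 3) (by simp [Rset]) 1
    rw [mul_one, map_add, add_eq_zero_iff_neg_eq] at this
    rw [one_mul, mul_one, this]
  h22 := by
    have := rr_Rset q (x := tt q 1 1 - tt q 2 2) (by simp [Rset]) 1
    rw [mul_one, map_sub, sub_eq_zero] at this
    rw [one_mul, mul_one, this]

variable {q} in
lemma Good.add {x y : AU q} (hx : Good q x) (hy : Good q y) : Good q (x + y) where
  up i l hi hl := by rw [add_mul, map_add, hx.up i l hi hl, hy.up i l hi hl, add_zero]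
  lo i l hi hl := by rw [add_mul, map_add, hx.lo i l hi hl, hy.lo i l hi hl, add_zero]
  h33 := by rw [add_mul, map_add, hx.h33, hy.h33, mul_add, map_add]
  h32 := by rw [add_mul, map_add, hx.h32, hy.h32, mul_add, map_add, neg_add]
  h23 := by rw [add_mul, map_add, hx.h23, hy.h23, mul_add, map_add, neg_add]
  h22 := by rw [add_mul, map_add, hx.h22, hy.h22, mul_add, map_add]

variable {q} in
lemma Good.smul {x : AU q} (hx : Good q x) (c : ℂ) : Good q (c • x) where
  up i l hi hl := by rw [smul_mul_assoc, map_smul, hx.up i l hi hl, smul_zero]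
  lo i l hi hl := by rw [smul_mul_assoc, map_smul, hx.lo i l hi hl, smul_zero]
  h33 := by rw [smul_mul_assoc, map_smul, hx.h33, mul_smul_comm, map_smul]
  h32 := by rw [smul_mul_assoc, map_smul, hx.h32, mul_smul_comm, map_smul, smul_neg]
  h23 := by rw [smul_mul_assoc, map_smul, hx.h23, mul_smul_comm, map_smul, smul_neg]
  h22 := by rw [smul_mul_assoc, map_smul, hx.h22, mul_smul_comm, map_smul]

variable {q} in
lemma Good.swap {x : AU q} (hx : Good q x) {i j k l : Fin 4} (hi : i < 2) (hj : j < 2)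
    (hk : 2 ≤ k) (hl : 2 ≤ l) :
    rr q (x * tt q i j * tt q k l) = rr q (x * tt q k l * tt q i j) := by
  rw [mul_assoc, tt_qcom q (hi.trans_le hk) (hj.trans_le hl), mul_add, map_add, mul_smul_comm,
    map_smul, ← mul_assoc x (tt q k j), rr_zero_mul q (hx.lo j k hj hk), smul_zero, add_zero,
    mul_assoc]

variable {q} in
lemma Good.mul_tt {x : AU q} (hx : Good q x) {i j : Fin 4} (hi : i < 2) (hj : j < 2) :
    Good q (x * tt q i j) where
  up k l hk hl := by
    rcases lt_trichotomy i k with h | h | h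
    · rw [mul_assoc, tt_qcom q h (hj.trans_le hl), ← tt_comm q h (hj.trans_le hl), mul_add,
        map_add, mul_smul_comm, map_smul, ← mul_assoc, ← mul_assoc,
        rr_zero_mul q (hx.up k l hk hl), rr_zero_mul q (hx.up i l hi hl), smul_zero, add_zero]
    · subst h
      rw [mul_assoc, tt_row q i (hj.trans_le hl), mul_smul_comm, map_smul, ← mul_assoc,
        rr_zero_mul q (hx.up i l hi hl), smul_zero]
    · rw [mul_assoc, ← tt_comm q h (hj.trans_le hl), ← mul_assoc,
        rr_zero_mul q (hx.up k l hk hl)]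
  lo k l hk hl := by
    rcases lt_trichotomy j k with h | h | h
    · rw [mul_assoc, tt_qcom q (hi.trans_le hl) h, mul_add,
        map_add, mul_smul_comm, map_smul, ← mul_assoc, ← mul_assoc,
        rr_zero_mul q (hx.lo k l hk hl), rr_zero_mul q (hx.lo j l hj hl), smul_zero, add_zero]
    · subst h
      rw [mul_assoc, tt_col q j (hi.trans_le hl), mul_smul_comm, map_smul, ← mul_assoc,
        rr_zero_mul q (hx.lo j l hj hl), smul_zero]
    · rw [mul_assoc, tt_comm q (hi.trans_le hl) h, ← mul_assoc,
        rr_zero_mul q (hx.lo k l hk hl)]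
  h33 := by
    rw [hx.swap hi hj (by decide) (by decide), rr_mul q hx.h33, mul_assoc]
  h32 := by
    rw [hx.swap hi hj (by decide) (by decide), rr_neg_mul q hx.h32, mul_assoc]
  h23 := by
    rw [hx.swap hi hj (by decide) (by decide), rr_neg_mul q hx.h23, mul_assoc]
  h22 := by
    rw [hx.swap hi hj (by decide) (by decide), rr_mul q hx.h22, mul_assoc]

/-- The subalgebra generated by the upper left block. -/
def BB : Subalgebra ℂ (AU q) :=
  Algebra.adjoin ℂ {y | ∃ i j : Fin 4, i < 2 ∧ j < 2 ∧ y = tt q i j}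

lemma tt_mem_BB {i j : Fin 4} (hi : i < 2) (hj : j < 2) : tt q i j ∈ BB q :=
  Algebra.subset_adjoin ⟨i, j, hi, hj, rfl⟩

variable {q} in
lemma good_mul_of_mem {b : AU q} (hb : b ∈ BB q) : ∀ x, Good q x → Good q (x * b) := by
  unfold BB at hb
  induction hb using Algebra.adjoin_induction with
  | mem y hy =>
    obtain ⟨i, j, hi, hj, rfl⟩ := hy
    exact fun x hx => hx.mul_tt hi hj
  | algebraMap c =>
    intro x hx
    rw [← Algebra.commutes, ← Algebra.smul_def]
    exact hx.smul c
  | add u v _ _ hu hv =>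
    intro x hx
    rw [mul_add]
    exact (hu x hx).add (hv x hx)
  | mul u v _ _ hu hv =>
    intro x hx
    rw [← mul_assoc]
    exact hv _ (hu x hx)

variable {q} in
lemma good_of_mem {b : AU q} (hb : b ∈ BB q) : Good q b := by
  simpa using good_mul_of_mem hb 1 (good_one q)

lemma bas_mem (k : ℤ) (m n : ℕ) : bas q k m n ∈ BB q := by
  have a := tt_mem_BB q (i := 0) (j := 0) (by decide) (by decide)
  have b := tt_mem_BB q (i := 0) (j := 1) (by decide) (by decide)
  have c := tt_mem_BB q (i := 1) (j := 0) (by decide) (by decide)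
  have d := tt_mem_BB q (i := 1) (j := 1) (by decide) (by decide)
  unfold bas
  split_ifs
  · exact mul_mem (mul_mem (pow_mem a _) (pow_mem b _)) (pow_mem c _)
  · exact mul_mem (mul_mem (pow_mem b _) (pow_mem c _)) (pow_mem d _)

lemma det_act (x : AU q) : rr q (tt q 0 0 * tt q 1 1 * x)
    - (q : ℂ) • rr q (tt q 0 1 * tt q 1 0 * x) = rr q x := by
  have := rr_Rset q (x := tt q 0 0 * tt q 1 1 - (q : ℂ) • (tt q 0 1 * tt q 1 0) - 1)
    (by simp [Rset]) x
  rw [sub_mul, one_mul, map_sub, sub_eq_zero, sub_mul, map_sub, smul_mul_assoc, map_smul] at this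
  exact this

/-- Two expansions of `y` against the third and fourth rows. -/
lemma rows_act {y : AU q} (hy : Good q y) (s : Fin 4 → AU q) :
    rr q (y * ∑ k, tt q 2 k * s k)
        = rr q (tt q 1 1 * y * s 2) - rr q (tt q 1 0 * y * s 3) ∧
    rr q (y * ∑ k, tt q 3 k * s k)
        = - rr q (tt q 0 1 * y * s 2) + rr q (tt q 0 0 * y * s 3) := by
  have n1 := rr_neg_mul q hy.h23 (s 3)
  have n2 := rr_neg_mul q hy.h32 (s 2)
  constructor
  · simp only [Fin.sum_univ_four, mul_add, map_add, ← mul_assoc]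
    rw [rr_zero_mul q (hy.lo 0 2 (by decide) (by decide)),
      rr_zero_mul q (hy.lo 1 2 (by decide) (by decide)), rr_mul q hy.h22, n1]
    abel
  · simp only [Fin.sum_univ_four, mul_add, map_add, ← mul_assoc]
    rw [rr_zero_mul q (hy.lo 0 3 (by decide) (by decide)),
      rr_zero_mul q (hy.lo 1 3 (by decide) (by decide)), rr_mul q hy.h33, n2]
    abel

/-- Solving for the action of a column `s` with prescribed `T s = (u, v)` in rows three, four. -/
lemma solve (hq0 : 0 < q) {x : AU q} (hx : x ∈ BB q) (s : Fin 4 → AU q) (u v : ℂ)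
    (hu : ∑ k, tt q 2 k * s k = u • 1) (hv : ∑ k, tt q 3 k * s k = v • 1) :
    rr q (x * s 2) = u • rr q (tt q 0 0 * x) + ((q : ℂ)⁻¹ * v) • rr q (tt q 1 0 * x) ∧
    rr q (x * s 3) = v • rr q (tt q 1 1 * x) + ((q : ℂ) * u) • rr q (tt q 0 1 * x) := by
  have hq : (q : ℂ) ≠ 0 := by exact_mod_cast hq0.ne'
  have a := tt_mem_BB q (i := 0) (j := 0) (by decide) (by decide)
  have b := tt_mem_BB q (i := 0) (j := 1) (by decide) (by decide)
  have c := tt_mem_BB q (i := 1) (j := 0) (by decide) (by decide)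
  have d := tt_mem_BB q (i := 1) (j := 1) (by decide) (by decide)
  have r1 : ∀ y, y ∈ BB q → rr q (tt q 1 1 * y * s 2) - rr q (tt q 1 0 * y * s 3)
      = u • rr q y := by
    intro y hy
    rw [← (rows_act q (good_of_mem hy) s).1, hu, mul_smul_comm, mul_one, map_smul]
  have r2 : ∀ y, y ∈ BB q → - rr q (tt q 0 1 * y * s 2) + rr q (tt q 0 0 * y * s 3)
      = v • rr q y := by
    intro y hy
    rw [← (rows_act q (good_of_mem hy) s).2, hv, mul_smul_comm, mul_one, map_smul]
  have eac : tt q 0 0 * tt q 1 0 = (q : ℂ) • (tt q 1 0 * tt q 0 0) := tt_col q 0 (by decide)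
  have ebd : tt q 0 1 * tt q 1 1 = (q : ℂ) • (tt q 1 1 * tt q 0 1) := tt_col q 1 (by decide)
  have ebc : tt q 0 1 * tt q 1 0 = tt q 1 0 * tt q 0 1 := tt_comm q (by decide) (by decide)
  have ead : tt q 0 0 * tt q 1 1 = tt q 1 1 * tt q 0 0
      + ((q : ℂ) - (q : ℂ)⁻¹) • (tt q 1 0 * tt q 0 1) := tt_qcom q (by decide) (by decide)
  constructor
  · have h1 := r1 _ (mul_mem a hx)
    have h2 := r2 _ (mul_mem c hx)
    have h3 := det_act q (x * s 2)
    simp only [← mul_assoc] at h1 h2 h3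
    rw [ead, ebc] at h3
    rw [eac, ebc] at h2
    simp only [add_mul, smul_mul_assoc, map_add, map_smul] at h1 h2 h3
    rw [← h3, ← h1, mul_smul, ← h2]
    match_scalars <;> field_simp <;> ring
  · have h1 := r1 _ (mul_mem b hx)
    have h2 := r2 _ (mul_mem d hx)
    have h3 := det_act q (x * s 3)
    simp only [← mul_assoc] at h1 h2 h3
    rw [ebc] at h3
    rw [ebd] at h2
    simp only [add_mul, smul_mul_assoc, map_add, map_smul] at h1 h2 h3
    rw [← h3, mul_smul, ← h1, ← h2]
    match_scalars <;> field_simp <;> ring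

section qpow
variable {A : Type*} [Ring A] [Algebra ℂ A]

lemma qpow_right {a b : A} {c : ℂ} (h : a * b = c • (b * a)) (n : ℕ) :
    a * b ^ n = c ^ n • (b ^ n * a) := by
  induction n with
  | zero => simp
  | succ n ih =>
    rw [pow_succ b, ← mul_assoc, ih, smul_mul_assoc, mul_assoc, h, mul_smul_comm, smul_smul,
      mul_assoc, pow_succ c]

lemma qpow_comm_right {a d p : A} {e f : ℂ} (had : a * d = d * a + e • p)
    (hp : p * d = f • (d * p)) (n : ℕ) :
    a * d ^ (n + 1) = d ^ (n + 1) * a + (e * ∑ i ∈ Finset.range (n + 1), f ^ i) • (d ^ n * p) := by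
  induction n with
  | zero => simp [had]
  | succ n ih =>
    rw [pow_succ d (n + 1), ← mul_assoc, ih, add_mul, mul_assoc (d ^ (n + 1)) a d, had, mul_add,
      smul_mul_assoc, mul_assoc (d ^ n) p d, hp, mul_smul_comm, mul_smul_comm, ← mul_assoc (d ^ n),
      ← pow_succ d, smul_smul, ← mul_assoc, add_assoc, ← add_smul]
    congr 2
    rw [Finset.sum_range_succ' _ (n + 1)]
    simp only [pow_succ f, ← Finset.sum_mul]
    ring

end qpow

variable {q} in
lemma geo1 (hq0 : 0 < q) (n : ℕ) :
    ((q : ℂ) - (q : ℂ)⁻¹) * ∑ i ∈ Finset.range n, ((q : ℂ) ^ 2) ^ i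
      = - ((q : ℂ)⁻¹ * (1 - (q : ℂ) ^ (2 * n))) := by
  have hq : (q : ℂ) ≠ 0 := by exact_mod_cast hq0.ne'
  have h := mul_geom_sum ((q : ℂ) ^ 2) n
  rw [pow_mul, show (q : ℂ) - (q : ℂ)⁻¹ = (q : ℂ)⁻¹ * ((q : ℂ) ^ 2 - 1) by field_simp, mul_assoc, h]
  ring

variable {q} in
lemma geo2 (hq0 : 0 < q) (n : ℕ) :
    (-((q : ℂ) - (q : ℂ)⁻¹)) * ∑ i ∈ Finset.range n, ((q : ℂ)⁻¹ ^ 2) ^ i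
      = - ((q : ℂ) * (1 - (q : ℂ)⁻¹ ^ (2 * n))) := by
  have hq : (q : ℂ) ≠ 0 := by exact_mod_cast hq0.ne'
  have h := mul_geom_sum ((q : ℂ)⁻¹ ^ 2) n
  rw [pow_mul, show -((q : ℂ) - (q : ℂ)⁻¹) = (q : ℂ) * ((q : ℂ)⁻¹ ^ 2 - 1) by field_simp; ring,
    mul_assoc, h]
  ring

section blk
variable {A : Type*} [Ring A] [Algebra ℂ A]

/-- Moving `a` through `b ^ m * c ^ n`. -/
lemma mid {a b c : A} {t : ℂ} (hab : a * b = t • (b * a)) (hac : a * c = t • (c * a))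
    (m n : ℕ) : a * (b ^ m * c ^ n) = t ^ (m + n) • (b ^ m * c ^ n * a) := by
  rw [← mul_assoc, qpow_right hab, smul_mul_assoc, mul_assoc, qpow_right hac, mul_smul_comm,
    smul_smul, pow_add, mul_assoc]

lemma neg_a {a b c d : A} {t e f : ℂ} (hab : a * b = t • (b * a)) (hac : a * c = t • (c * a))
    (had : a * d = d * a + e • (b * c)) (hp : b * c * d = f • (d * (b * c))) (m n k : ℕ) :
    a * (b ^ m * c ^ n * d ^ (k + 1)) = t ^ (m + n) • (b ^ m * c ^ n * d ^ (k + 1) * a)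
      + (t ^ (m + n) * (e * ∑ i ∈ Finset.range (k + 1), f ^ i)) •
        (b ^ m * c ^ n * d ^ k * (b * c)) := by
  rw [← mul_assoc, ← mul_assoc, mul_assoc a, mid hab hac, smul_mul_assoc, mul_assoc (_ * _) a,
    qpow_comm_right had hp, mul_add, smul_add, mul_smul_comm, smul_smul]
  simp only [mul_assoc]

lemma pos_d {a b c d : A} {t e f : ℂ} (hab : d * b = t • (b * d)) (hac : d * c = t • (c * d))
    (hbc : b * c = c * b)
    (had : d * a = a * d + e • (b * c)) (hp : b * c * a = f • (a * (b * c))) (m n k : ℕ) :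
    d * (a ^ (k + 1) * b ^ m * c ^ n) = t ^ (m + n) • (a ^ (k + 1) * b ^ m * c ^ n * d)
      + (e * ∑ i ∈ Finset.range (k + 1), f ^ i) •
        (a ^ k * b ^ m * c ^ n * (b * c)) := by
  have hB : Commute (b * c) (b ^ m) :=
    Commute.pow_right (Commute.mul_left (Commute.refl b) (hbc.symm : Commute c b)) m
  have hC : Commute (b * c) (c ^ n) :=
    Commute.pow_right (Commute.mul_left (hbc : Commute b c) (Commute.refl c)) n
  rw [mul_assoc (a ^ (k + 1)), ← mul_assoc d, qpow_comm_right had hp, add_mul, mul_assoc _ d,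
    mid hab hac, mul_smul_comm, smul_mul_assoc, mul_assoc (a ^ k) (b * c),
    (hB.mul_right hC).eq]
  simp only [mul_assoc]

lemma pos_b {a b c : A} {t : ℂ} (ht : t ≠ 0) (hab : a * b = t • (b * a)) (hbc : b * c = c * b)
    (k m n : ℕ) : b * (a ^ k * b ^ m * c ^ n) = t⁻¹ ^ k • (a ^ k * b ^ m * c ^ n * b) := by
  have h : b * a = t⁻¹ • (a * b) := by rw [hab, smul_smul, inv_mul_cancel₀ ht, one_smul]
  rw [mul_assoc, ← mul_assoc b, qpow_right h, smul_mul_assoc, mul_assoc, ← mul_assoc b,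
    ← pow_succ', pow_succ, mul_assoc, ((Commute.pow_right hbc n : Commute b (c ^ n))).eq]
  simp only [mul_assoc]

lemma pos_c {a b c : A} {t : ℂ} (ht : t ≠ 0) (hac : a * c = t • (c * a)) (hbc : b * c = c * b)
    (k m n : ℕ) : c * (a ^ k * b ^ m * c ^ n) = t⁻¹ ^ k • (a ^ k * b ^ m * c ^ n * c) := by
  have h : c * a = t⁻¹ • (a * c) := by rw [hac, smul_smul, inv_mul_cancel₀ ht, one_smul]
  rw [mul_assoc, ← mul_assoc c, qpow_right h, smul_mul_assoc, mul_assoc, ← mul_assoc c,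
    ((Commute.pow_right hbc.symm m : Commute c (b ^ m))).eq, mul_assoc (b ^ m), ← pow_succ',
    pow_succ]
  simp only [mul_assoc]

lemma neg_b {b c d : A} {t : ℂ} (hbd : b * d = t • (d * b)) (hbc : b * c = c * b)
    (m n k : ℕ) : b * (b ^ m * c ^ n * d ^ k) = t ^ k • (b ^ m * c ^ n * d ^ k * b) := by
  rw [mul_assoc, ← mul_assoc b, ← pow_succ', pow_succ, mul_assoc, ← mul_assoc b,
    ((Commute.pow_right hbc n : Commute b (c ^ n))).eq, mul_assoc (c ^ n), qpow_right hbd]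
  simp only [mul_assoc, mul_smul_comm]

lemma neg_c {b c d : A} {t : ℂ} (hcd : c * d = t • (d * c)) (hbc : b * c = c * b)
    (m n k : ℕ) : c * (b ^ m * c ^ n * d ^ k) = t ^ k • (b ^ m * c ^ n * d ^ k * c) := by
  rw [mul_assoc, ← mul_assoc c, ((Commute.pow_right hbc.symm m : Commute c (b ^ m))).eq,
    mul_assoc (b ^ m), ← mul_assoc c, ← pow_succ', pow_succ, mul_assoc (c ^ n), qpow_right hcd]
  simp only [mul_assoc, mul_smul_comm]

end blk

lemma bas_pos (k m n : ℕ) :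
    bas q (k : ℤ) m n = tt q 0 0 ^ k * tt q 0 1 ^ m * tt q 1 0 ^ n := by
  simp [bas]

lemma bas_neg (k m n : ℕ) :
    bas q (-(k : ℤ)) m n = tt q 0 1 ^ m * tt q 1 0 ^ n * tt q 1 1 ^ k := by
  rcases Nat.eq_zero_or_pos k with rfl | h
  · simp [bas]
  · have : ¬ (0 : ℤ) ≤ -(k : ℤ) := by omega
    rw [bas, if_neg this, neg_neg, Int.toNat_natCast]

theorem module_relations_star_block22 (q : ℝ) (hq0 : 0 < q) (hq1 : q < 1)
    [StarRing (AU q)] [StarModule ℂ (AU q)]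
    (S : AU q →ₗ[ℂ] AU q)
    (hSanti : ∀ x y : AU q, S (x * y) = S y * S x) (hS1 : S 1 = 1)
    (hSleft : ∀ i j : Fin 4, ∑ k : Fin 4, S (tt q i k) * tt q k j = if i = j then 1 else 0)
    (hSright : ∀ i j : Fin 4, ∑ k : Fin 4, tt q i k * S (tt q k j) = if i = j then 1 else 0)
    (hSD : S (Dq q) = dI q) (hSDi : S (dI q) = Dq q)
    (hstarT : ∀ i j : Fin 4, star (tt q i j) = S (tt q j i))
    (hstarD : star (Dq q) = dI q)
    (k : ℤ) (m n : ℕ)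
        : rr q (bas q k m n * star (tt q 2 2))
      = ((q : ℂ) ^ ((m : ℤ) + (n : ℤ))) • rr q (bas q k m n * tt q 0 0)
        - (thetaZ (-k) * (q : ℂ) ^ ((m : ℤ) + (n : ℤ) - 1) * (1 - (q : ℂ) ^ (-(2 * k)))) •
            rr q (bas q (k + 1) m n * (tt q 0 1 * tt q 1 0)) ∧
    rr q (bas q k m n * star (tt q 2 3)) = ((q : ℂ) ^ (1 - k)) • rr q (bas q k m n * tt q 0 1) ∧
    rr q (bas q k m n * star (tt q 3 2)) = ((q : ℂ) ^ (-(1 + k))) • rr q (bas q k m n * tt q 1 0) ∧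
    rr q (bas q k m n * star (tt q 3 3))
      = ((q : ℂ) ^ (-((m : ℤ) + (n : ℤ)))) • rr q (bas q k m n * tt q 1 1)
        - (thetaZ k * (q : ℂ) * (1 - (q : ℂ) ^ (-(2 * k)))) •
            rr q (bas q (k - 1) m n * (tt q 0 1 * tt q 1 0)) := by
  have hq : (q : ℂ) ≠ 0 := by exact_mod_cast hq0.ne'
  have eab : tt q 0 0 * tt q 0 1 = (q : ℂ) • (tt q 0 1 * tt q 0 0) := tt_row q 0 (by decide)
  have ecd : tt q 1 0 * tt q 1 1 = (q : ℂ) • (tt q 1 1 * tt q 1 0) := tt_row q 1 (by decide)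
  have eac : tt q 0 0 * tt q 1 0 = (q : ℂ) • (tt q 1 0 * tt q 0 0) := tt_col q 0 (by decide)
  have ebd : tt q 0 1 * tt q 1 1 = (q : ℂ) • (tt q 1 1 * tt q 0 1) := tt_col q 1 (by decide)
  have ebc : tt q 0 1 * tt q 1 0 = tt q 1 0 * tt q 0 1 := tt_comm q (by decide) (by decide)
  have ead : tt q 0 0 * tt q 1 1 = tt q 1 1 * tt q 0 0
      + ((q : ℂ) - (q : ℂ)⁻¹) • (tt q 0 1 * tt q 1 0) := by
    rw [ebc]
    exact tt_qcom q (by decide) (by decide)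
  have eda : tt q 1 1 * tt q 0 0 = tt q 0 0 * tt q 1 1
      + (-((q : ℂ) - (q : ℂ)⁻¹)) • (tt q 0 1 * tt q 1 0) := by
    rw [ead, add_assoc, ← add_smul, add_neg_cancel, zero_smul, add_zero]
  have edb : tt q 1 1 * tt q 0 1 = (q : ℂ)⁻¹ • (tt q 0 1 * tt q 1 1) := by
    rw [ebd, smul_smul, inv_mul_cancel₀ hq, one_smul]
  have edc : tt q 1 1 * tt q 1 0 = (q : ℂ)⁻¹ • (tt q 1 0 * tt q 1 1) := by
    rw [ecd, smul_smul, inv_mul_cancel₀ hq, one_smul]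
  have eba : tt q 0 1 * tt q 0 0 = (q : ℂ)⁻¹ • (tt q 0 0 * tt q 0 1) := by
    rw [eab, smul_smul, inv_mul_cancel₀ hq, one_smul]
  have eca : tt q 1 0 * tt q 0 0 = (q : ℂ)⁻¹ • (tt q 0 0 * tt q 1 0) := by
    rw [eac, smul_smul, inv_mul_cancel₀ hq, one_smul]
  have epd : tt q 0 1 * tt q 1 0 * tt q 1 1
      = ((q : ℂ) ^ 2) • (tt q 1 1 * (tt q 0 1 * tt q 1 0)) := by
    rw [mul_assoc, ecd, mul_smul_comm, ← mul_assoc, ebd, smul_mul_assoc, smul_smul, mul_assoc,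
      pow_two]
  have epa : tt q 0 1 * tt q 1 0 * tt q 0 0
      = ((q : ℂ)⁻¹ ^ 2) • (tt q 0 0 * (tt q 0 1 * tt q 1 0)) := by
    rw [mul_assoc, eca, mul_smul_comm, ← mul_assoc, eba, smul_mul_assoc, smul_smul, mul_assoc,
      pow_two]
  have hx := bas_mem q k m n
  have s1 := solve q hq0 hx (fun i => S (tt q i 2)) 1 0
    (by rw [hSright 2 2, if_pos rfl, one_smul])
    (by rw [hSright 3 2, if_neg (by decide), zero_smul])
  have s2 := solve q hq0 hx (fun i => S (tt q i 3)) 0 1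
    (by rw [hSright 2 3, if_neg (by decide), zero_smul])
    (by rw [hSright 3 3, if_pos rfl, one_smul])
  simp only [one_smul, zero_smul, mul_zero, mul_one, add_zero, zero_add] at s1 s2
  rw [hstarT, hstarT, hstarT, hstarT, s1.1, s1.2, s2.1, s2.2]
  clear s1 s2 hx
  rcases le_or_gt 0 k with hk | hk
  · obtain ⟨K, rfl⟩ := Int.eq_ofNat_of_zero_le hk
    refine ⟨?_, ?_, ?_, ?_⟩
    · have h0 : thetaZ (-(K : ℤ)) * (q : ℂ) ^ ((m : ℤ) + (n : ℤ) - 1)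
          * (1 - (q : ℂ) ^ (-(2 * (K : ℤ)))) = 0 := by
        rcases Nat.eq_zero_or_pos K with rfl | h
        · simp
        · rw [thetaZ, if_neg (by omega), zero_mul, zero_mul]
      rw [h0, zero_smul, sub_zero, bas_pos, mul_assoc (_ ^ K), ← mul_assoc, ← pow_succ', pow_succ,
        mul_assoc, mid eab eac, mul_smul_comm, map_smul]
      simp only [mul_assoc]
      norm_cast
    · rw [bas_pos, pos_b hq eab ebc, map_smul, smul_smul, zpow_sub₀ hq, zpow_one, zpow_natCast,
        inv_pow, div_eq_mul_inv]
    · rw [bas_pos, pos_c hq eac ebc, map_smul, smul_smul, zpow_neg, zpow_add₀ hq, zpow_one,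
        zpow_natCast, inv_pow, mul_inv]
    · rw [thetaZ, if_pos hk, one_mul]
      rcases K with _ | K
      · rw [bas_pos, pow_zero, one_mul, mid edb edc, map_smul, zpow_neg]
        simp [← Nat.cast_add, -Nat.cast_add, zpow_natCast]
        norm_cast
      · rw [show ((K + 1 : ℕ) : ℤ) - 1 = (K : ℤ) by push_cast; ring, bas_pos, bas_pos,
          pos_d edb edc ebc eda epa, geo2 hq0, map_add, map_smul, map_smul, neg_smul,
          ← sub_eq_add_neg, zpow_neg, zpow_neg, inv_pow, inv_pow]
        norm_cast
  · obtain ⟨K, rfl⟩ : ∃ K : ℕ, k = -((K + 1 : ℕ) : ℤ) := ⟨(-k).toNat - 1, by omega⟩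
    refine ⟨?_, ?_, ?_, ?_⟩
    · rw [thetaZ, if_pos (by omega), one_mul,
        show -((K + 1 : ℕ) : ℤ) + 1 = -(K : ℤ) by push_cast; ring, bas_neg, bas_neg,
        neg_a eab eac ead epd, geo1 hq0, map_add, map_smul, map_smul, mul_neg, neg_smul,
        ← sub_eq_add_neg, mul_neg, neg_neg, zpow_sub₀ hq, zpow_one, div_eq_mul_inv, ← mul_assoc]
      norm_cast
    · rw [bas_neg, neg_b ebd ebc, map_smul, smul_smul, sub_neg_eq_add, zpow_add₀ hq, zpow_one,
        zpow_natCast]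
    · rw [bas_neg, neg_c ecd ebc, map_smul, smul_smul, neg_add, neg_neg, zpow_add₀ hq, zpow_neg,
        zpow_one, zpow_natCast]
    · rw [thetaZ, if_neg (by omega), zero_mul, zero_mul, zero_smul, sub_zero, bas_neg, ← mul_assoc,
        mid edb edc, smul_mul_assoc, map_smul, mul_assoc _ (tt q 1 1), ← pow_succ', pow_succ,
        mul_assoc (_ * _), zpow_neg, inv_pow]
      norm_cast

end QIB
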